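/- Let Ω be a domain (nonempty connected open set) in ℂ, and let {f_j} be a sequence of harmonic functions on Ω that is uniformly bounded on each compact subset of Ω (i.e., for each compact K ⊆ Ω there is M_K > 0 with |f_j(z)| ≤ M_K for all j and all z ∈ K). Then there is a subsequence {f_{j_k}} converging uniformly on every compact subset of Ω to a harmonic function on Ω. -/

import Mathlib

open Filter Topology

/-- The Laplacian of a function `u : ℂ → ℂ`, viewing `ℂ ≅ ℝ²`:
`Δu = ∂²u/∂x² + ∂²u/∂y²`, computed as the sum of the second directional
derivatives in the directions `1` and `I`. -/
noncomputable def laplacian (u : ℂ → ℂ) (z : ℂ) : ℂ :=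
  fderiv ℝ (fun w => fderiv ℝ u w 1) z 1 +
    fderiv ℝ (fun w => fderiv ℝ u w Complex.I) z Complex.I

/-- A function is harmonic on an open set `U ⊆ ℂ` if it is twice continuously
(real-)differentiable there and its Laplacian vanishes identically on `U`. -/
def HarmonicOnSet (u : ℂ → ℂ) (U : Set ℂ) : Prop :=
  ContDiffOn ℝ 2 u U ∧ ∀ z ∈ U, laplacian u z = 0

open Metric Complex in
/-- A circle average of a real function is bounded by any bound on the circle. -/
theorem abs_circleAverage_le_of_abs_le {F : ℂ → ℝ} {c : ℂ} {R C : ℝ}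
    (hF : CircleIntegrable F c R) (h : ∀ z ∈ sphere c |R|, |F z| ≤ C) :
    |Real.circleAverage F c R| ≤ C :=
  Real.abs_circleAverage_le_circleAverage_abs.trans
    (Real.circleAverage_mono_on_of_le_circle hF.abs h)

open Metric Complex in
/-- The Poisson kernel is continuous on the circle of integration. -/
theorem continuousOn_poissonKernel_sphere {c w : ℂ} {R : ℝ} (hw : w ∈ ball c R) :
    ContinuousOn (poissonKernel c w) (sphere c |R|) := by
  rw [poissonKernel_eq_re_herglotzRieszKernel]
  exact continuous_re.comp_continuousOn (continuousOn_herglotzRieszKernel_sphere hw)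

open Metric Complex in
/-- The Poisson integral of a continuous function is harmonic in the disk. -/
theorem harmonicOnNhd_of_eq_poisson_integral {u : ℂ → ℝ} {c : ℂ} {R : ℝ}
    (hu : ContinuousOn u (sphere c |R|))
    (h : ∀ w ∈ ball c R, Real.circleAverage (poissonKernel c w • u) c R = u w) :
    InnerProductSpace.HarmonicOnNhd u (ball c R) := by
  intro w hw
  have hmaps : Set.MapsTo (fun z : ℂ => z + c) (sphere 0 |R|) (sphere c |R|) := by
    intro z hz
    simpa [dist_eq_norm] using hz
  have hint : CircleIntegrable (fun z => u (z + c)) 0 R :=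
    (hu.comp (by fun_prop) hmaps).circleIntegrable'
  have hintC : CircleIntegrable (fun z => (u (z + c) : ℂ)) 0 R :=
    (continuous_ofReal.comp_continuousOn (hu.comp (by fun_prop) hmaps)).circleIntegrable'
  have hsub : ∀ v ∈ ball c R, v - c ∈ ball (0 : ℂ) R := by
    intro v hv
    simpa [dist_eq_norm] using hv
  have han : AnalyticAt ℂ (fun v => Real.circleAverage
      (fun ζ => herglotzRieszKernel 0 (v - c) ζ • (u (ζ + c) : ℂ)) 0 R) w :=
    (analyticOnNhd_circleAverage_herglotzRieszKernel_smul hintC (w - c) (hsub w hw)).comp_of_eq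
      (f := fun v : ℂ => v - c) (by fun_prop) rfl
  refine (InnerProductSpace.harmonicAt_congr_nhds ?_).1 han.harmonicAt_re
  filter_upwards [isOpen_ball.mem_nhds hw] with v hv
  rw [re_circleAverage_herglotzRieszKernel_smul hint (hsub v hv), ← h v hv,
    poissonKernel_eq_re_herglotzRieszKernel, ← Real.circleAverage_map_add_const (c := c)]
  congr 1
  ext z
  simp [herglotzRieszKernel_def]

open Metric Complex in
/-- A uniform limit of harmonic functions on a closed disk is harmonic in the open disk. -/
theorem harmonicOnNhd_ball_of_tendstoUniformlyOn {u : ℕ → ℂ → ℝ} {v : ℂ → ℝ} {c : ℂ} {R : ℝ}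
    (hR : 0 < R)
    (hu : ∀ n, InnerProductSpace.HarmonicOnNhd (u n) (closedBall c R))
    (huv : TendstoUniformlyOn u v atTop (closedBall c R)) :
    InnerProductSpace.HarmonicOnNhd v (ball c R) := by
  have hsph : sphere c |R| ⊆ closedBall c R := by
    rw [abs_of_pos hR]
    exact sphere_subset_closedBall
  have hcu : ∀ n, ContinuousOn (u n) (sphere c |R|) :=
    fun n => (hu n).contDiffOn.continuousOn.mono hsph
  have hcv : ContinuousOn v (sphere c |R|) :=
    (huv.mono hsph).continuousOn (Frequently.of_forall hcu)
  refine harmonicOnNhd_of_eq_poisson_integral hcv fun w hw => ?_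
  have hP := continuousOn_poissonKernel_sphere hw
  obtain ⟨B, hB⟩ := (isCompact_sphere c |R|).exists_bound_of_continuousOn hP
  have hBpos : 0 < |B| + 1 := by positivity
  refine tendsto_nhds_unique ?_ (huv.tendsto_at (ball_subset_closedBall hw))
  rw [Metric.tendsto_atTop']
  intro ε hε
  obtain ⟨N, hN⟩ := eventually_atTop.1
    (Metric.tendstoUniformlyOn_iff.1 huv (ε / 2 / (|B| + 1)) (by positivity))
  refine ⟨N, fun n hn => ?_⟩
  rw [← (hu n).circleAverage_poissonKernel_smul hw, Real.dist_eq, ← Real.circleAverage_sub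
    (hP.smul (hcu n)).circleIntegrable' (hP.smul hcv).circleIntegrable']
  refine (abs_circleAverage_le_of_abs_le (C := ε / 2)
    ((hP.smul (hcu n)).sub (hP.smul hcv)).circleIntegrable' fun z hz => ?_).trans_lt (by linarith)
  have h1 : |poissonKernel c w z| ≤ |B| + 1 := by
    have := hB z hz
    rw [Real.norm_eq_abs] at this
    linarith [le_abs_self B]
  have h2 : |u n z - v z| ≤ ε / 2 / (|B| + 1) := by
    have := hN n hn.le z (hsph hz)
    rw [dist_comm, Real.dist_eq] at this
    exact this.le
  calc |(poissonKernel c w • u n - poissonKernel c w • v) z|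
      = |poissonKernel c w z| * |u n z - v z| := by
        simp [← mul_sub, abs_mul]
    _ ≤ (|B| + 1) * (ε / 2 / (|B| + 1)) := by gcongr
    _ = ε / 2 := by field_simp

open Metric Complex in
/-- A bounded harmonic function on a disk has a modulus of continuity at the centre depending only
on the bound and the radius. -/
theorem abs_sub_center_le_of_harmonicOnNhd {u : ℂ → ℝ} {c w : ℂ} {R M : ℝ}
    (hu : InnerProductSpace.HarmonicOnNhd u (closedBall c R))
    (hM : ∀ z ∈ closedBall c R, |u z| ≤ M) (hw : w ∈ ball c R) :
    |u w - u c| ≤ 2 * ‖w - c‖ / (R - ‖w - c‖) * M := by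
  have hR : 0 < R := pos_of_mem_ball hw
  have hr : ‖w - c‖ < R := mem_ball_iff_norm.1 hw
  have hsph : sphere c |R| ⊆ closedBall c R := by
    rw [abs_of_pos hR]
    exact sphere_subset_closedBall
  have hcu : ContinuousOn u (sphere c |R|) := hu.contDiffOn.continuousOn.mono hsph
  have hPw := continuousOn_poissonKernel_sphere hw
  have hc : Real.circleAverage u c R = u c :=
    InnerProductSpace.HarmonicOnNhd.circleAverage_eq (by rwa [abs_of_pos hR])
  rw [← hc, ← hu.circleAverage_poissonKernel_smul hw,
    ← Real.circleAverage_sub (hPw.smul hcu).circleIntegrable' hcu.circleIntegrable']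
  refine abs_circleAverage_le_of_abs_le ((hPw.smul hcu).sub hcu).circleIntegrable' fun z hz => ?_
  have hz' : z ∈ sphere c R := by rwa [abs_of_pos hR] at hz
  have hup := re_herglotzRieszKernel_le hz' hw
  have hlo := le_re_herglotzRieszKernel hz' hw
  have hker : ((z - c + (w - c)) / (z - c - (w - c))).re = poissonKernel c w z := by
    rw [poissonKernel_eq_re_herglotzRieszKernel]
    rfl
  rw [hker] at hup hlo
  have hd : 0 < R - ‖w - c‖ := by linarith
  have hn := norm_nonneg (w - c)
  have h1 : |poissonKernel c w z - 1| ≤ 2 * ‖w - c‖ / (R - ‖w - c‖) := by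
    have e1 : (R + ‖w - c‖) / (R - ‖w - c‖) = 1 + 2 * ‖w - c‖ / (R - ‖w - c‖) := by
      field_simp
      ring
    have e2 : (R - ‖w - c‖) / (R + ‖w - c‖) = 1 - 2 * ‖w - c‖ / (R + ‖w - c‖) := by
      field_simp
      ring
    have e3 : 2 * ‖w - c‖ / (R + ‖w - c‖) ≤ 2 * ‖w - c‖ / (R - ‖w - c‖) := by
      gcongr
      linarith
    rw [abs_le]
    constructor <;> linarith
  calc |(poissonKernel c w • u - u) z| = |poissonKernel c w z - 1| * |u z| := by
        rw [← abs_mul]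
        simp [sub_mul]
    _ ≤ 2 * ‖w - c‖ / (R - ‖w - c‖) * M := by
        gcongr
        exact hM z (hsph hz)

open InnerProductSpace in
/-- The coordinate Laplacian agrees with the Mathlib one at points where the function is `C²`. -/
theorem laplacian_eq_mathlib_laplacian {u : ℂ → ℂ} {z : ℂ} (hu : ContDiffAt ℝ 2 u z) :
    _root_.laplacian u z = Laplacian.laplacian u z := by
  have hd : DifferentiableAt ℝ (fderiv ℝ u) z :=
    (hu.fderiv_right (m := 1) (by norm_num)).differentiableAt (by norm_num)
  simp only [_root_.laplacian, laplacian_eq_iteratedFDeriv_complexPlane, iteratedFDeriv_two_apply]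
  rw [fderiv_clm_apply hd (by fun_prop), fderiv_clm_apply hd (by fun_prop)]
  simp

/-- On open sets, the coordinate notion of harmonicity agrees with the Mathlib one. -/
theorem harmonicOnSet_iff_harmonicOnNhd {u : ℂ → ℂ} {U : Set ℂ} (hU : IsOpen U) :
    HarmonicOnSet u U ↔ InnerProductSpace.HarmonicOnNhd u U := by
  constructor
  · rintro ⟨hd, hl⟩ z hz
    refine ⟨hd.contDiffAt (hU.mem_nhds hz), ?_⟩
    filter_upwards [hU.mem_nhds hz] with w hw
    rw [← laplacian_eq_mathlib_laplacian (hd.contDiffAt (hU.mem_nhds hw)), hl w hw]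
    rfl
  · intro h
    refine ⟨h.contDiffOn, fun z hz => ?_⟩
    rw [laplacian_eq_mathlib_laplacian (h z hz).1]
    exact (h z hz).2.eq_of_nhds

open Metric in
/-- A locally uniformly bounded family of harmonic functions is equicontinuous. -/
theorem equicontinuous_of_harmonicOnNhd {ι : Type*} {Ω : Set ℂ} (hΩ : IsOpen Ω) {f : ι → ℂ → ℂ}
    (hf : ∀ j, InnerProductSpace.HarmonicOnNhd (f j) Ω)
    (hbd : ∀ K ⊆ Ω, IsCompact K → ∃ M > 0, ∀ j, ∀ z ∈ K, ‖f j z‖ ≤ M) :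
    Equicontinuous fun j (z : Ω) => f j z := by
  rintro ⟨c, hc⟩
  obtain ⟨R, hR, hsub⟩ := nhds_basis_closedBall.mem_iff.1 (hΩ.mem_nhds hc)
  obtain ⟨M, hM, hbound⟩ := hbd _ hsub (isCompact_closedBall c R)
  refine equicontinuousAt_of_continuity_modulus
    (fun z : Ω => 2 * (2 * ‖(z : ℂ) - c‖ / (R - ‖(z : ℂ) - c‖) * M)) ?_ _ ?_
  · have : ContinuousAt (fun z : Ω => 2 * (2 * ‖(z : ℂ) - c‖ / (R - ‖(z : ℂ) - c‖) * M))
        ⟨c, hc⟩ := by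
      refine ContinuousAt.mul (by fun_prop) (ContinuousAt.mul (ContinuousAt.div ?_ ?_ ?_) ?_)
      · fun_prop
      · fun_prop
      · simpa using hR.ne'
      · fun_prop
    simpa [ContinuousAt] using this
  · have hball : ∀ᶠ z : Ω in 𝓝 ⟨c, hc⟩, (z : ℂ) ∈ ball c R :=
      continuous_subtype_val.continuousAt.eventually (isOpen_ball.mem_nhds (mem_ball_self hR))
    filter_upwards [hball] with z hz j
    have hre := abs_sub_center_le_of_harmonicOnNhd (M := M)
      (((hf j).mono hsub).comp_CLM Complex.reCLM)
      (fun x hx => (Complex.abs_re_le_norm _).trans (hbound j x hx)) hz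
    have him := abs_sub_center_le_of_harmonicOnNhd (M := M)
      (((hf j).mono hsub).comp_CLM Complex.imCLM)
      (fun x hx => (Complex.abs_im_le_norm _).trans (hbound j x hx)) hz
    rw [dist_comm, dist_eq_norm]
    refine (Complex.norm_le_abs_re_add_abs_im _).trans ?_
    simp only [Function.comp_apply, Complex.reCLM_apply, Complex.imCLM_apply] at hre him
    rw [Complex.sub_re, Complex.sub_im]
    linarith

open Metric in
/-- A locally uniform limit of harmonic functions is harmonic. -/
theorem harmonicOnNhd_of_tendstoUniformlyOn {Ω : Set ℂ} (hΩ : IsOpen Ω) {f : ℕ → ℂ → ℂ}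
    {g : ℂ → ℂ} (hf : ∀ j, InnerProductSpace.HarmonicOnNhd (f j) Ω)
    (hfg : ∀ K ⊆ Ω, IsCompact K → TendstoUniformlyOn f g atTop K) :
    InnerProductSpace.HarmonicOnNhd g Ω := by
  intro c hc
  obtain ⟨R, hR, hsub⟩ := nhds_basis_closedBall.mem_iff.1 (hΩ.mem_nhds hc)
  have hlim := hfg _ hsub (isCompact_closedBall c R)
  have hre := harmonicOnNhd_ball_of_tendstoUniformlyOn hR
    (fun n => ((hf n).mono hsub).comp_CLM Complex.reCLM)
    (Complex.reCLM.uniformContinuous.comp_tendstoUniformlyOn hlim) c (mem_ball_self hR)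
  have him := harmonicOnNhd_ball_of_tendstoUniformlyOn hR
    (fun n => ((hf n).mono hsub).comp_CLM Complex.imCLM)
    (Complex.imCLM.uniformContinuous.comp_tendstoUniformlyOn hlim) c (mem_ball_self hR)
  have hsum := (hre.comp_CLM Complex.ofRealCLM).add
    ((him.comp_CLM Complex.ofRealCLM).comp_CLM (ContinuousLinearMap.mul ℝ ℂ Complex.I))
  refine (InnerProductSpace.harmonicAt_congr_nhds (Eventually.of_forall fun z => ?_)).1 hsum
  simpa [mul_comm] using Complex.re_add_im (g z)

/-- **Montel-type theorem for harmonic functions.** A sequence of harmonic functions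
on a planar domain that is uniformly bounded on each compact subset has a subsequence
converging uniformly on compact subsets to a harmonic function. -/
theorem harmonic_montel
    (Ω : Set ℂ) (hΩopen : IsOpen Ω) (hΩconn : IsConnected Ω)
    (f : ℕ → ℂ → ℂ)
    (hf : ∀ j, HarmonicOnSet (f j) Ω)
    (hbd : ∀ K ⊆ Ω, IsCompact K → ∃ M > 0, ∀ j, ∀ z ∈ K, ‖f j z‖ ≤ M) :
    ∃ (φ : ℕ → ℕ) (g : ℂ → ℂ), StrictMono φ ∧ HarmonicOnSet g Ω ∧
      ∀ K ⊆ Ω, IsCompact K → TendstoUniformlyOn (fun k => f (φ k)) g atTop K := by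
  have hharm := fun j => (harmonicOnSet_iff_harmonicOnNhd hΩopen).1 (hf j)
  have : LocallyCompactSpace Ω := hΩopen.locallyCompactSpace
  let F : ℕ → C(Ω, ℂ) := fun j => ⟨Ω.domRestrict (f j), (hf j).1.continuousOn.domRestrict⟩
  have heq : Equicontinuous fun j (z : Ω) => f j z :=
    equicontinuous_of_harmonicOnNhd hΩopen hharm hbd
  have hcomp : IsCompact (closure (Set.range F)) := by
    refine ArzelaAscoli.isCompact_closure_of_isClosedEmbedding (𝔖 := {K : Set Ω | IsCompact K})
      (F := fun (h : C(Ω, ℂ)) => (h : Ω → ℂ)) (fun K hK => hK)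
      ⟨ContinuousMap.isUniformEmbedding_toUniformOnFunIsCompact.isEmbedding, ?_⟩ ?_ ?_
    · have : T2Space (UniformOnFun Ω ℂ {K : Set Ω | IsCompact K}) :=
        UniformOnFun.t2Space_of_covering (Set.sUnion_eq_univ_iff.2
          fun x => ⟨{x}, isCompact_singleton, Set.mem_singleton x⟩)
      exact ContinuousMap.isUniformEmbedding_toUniformOnFunIsCompact.isUniformInducing
        |>.isComplete_range.isClosed
    · intro K hK
      refine Equicontinuous.equicontinuousOn ?_ K
      intro x U hU
      filter_upwards [heq x U hU] with y hy
      rintro ⟨_, j, rfl⟩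
      exact hy j
    · intro K hK x hx
      obtain ⟨M, -, hM⟩ := hbd {(x : ℂ)} (by simp) isCompact_singleton
      refine ⟨Metric.closedBall 0 M, isCompact_closedBall 0 M, ?_⟩
      rintro _ ⟨j, rfl⟩
      exact mem_closedBall_zero_iff.2 (hM j x rfl)
  obtain ⟨G, -, φ, hφ, hlim⟩ := hcomp.tendsto_subseq fun j => subset_closure (Set.mem_range_self j)
  have hconv : ∀ K ⊆ Ω, IsCompact K →
      TendstoUniformlyOn (fun k => f (φ k)) (Function.extend Subtype.val G 0) atTop K := by
    intro K hK hKc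
    have hpre : IsCompact ((↑) ⁻¹' K : Set Ω) := by
      rwa [Subtype.isCompact_iff, Subtype.image_preimage_coe, Set.inter_eq_right.2 hK]
    have h := ContinuousMap.tendsto_iff_forall_isCompact_tendstoUniformlyOn.1 hlim _ hpre
    rw [Metric.tendstoUniformlyOn_iff] at h ⊢
    intro ε hε
    filter_upwards [h ε hε] with k hk z hz
    have hz' := hk ⟨z, hK hz⟩ hz
    rw [← Subtype.val_injective.extend_apply G 0 ⟨z, hK hz⟩] at hz'
    exact hz'
  exact ⟨φ, _, hφ, (harmonicOnSet_iff_harmonicOnNhd hΩopen).2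
    (harmonicOnNhd_of_tendstoUniformlyOn hΩopen (fun k => hharm (φ k)) hconv), hconv⟩
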